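/- Let P be a predicate on finite groups, and let L and L_c be finite lattices. Suppose: (1) P is interval enforceable by L, i.e., every finite group G with a subgroup H such that ⟦H,G⟧ is order-isomorphic to L satisfies P; (2) the negation of P is interval enforceable by L_c, i.e., every finite group G with a subgroup H such that ⟦H,G⟧ is order-isomorphic to L_c fails P; (3) there exist a finite group G₁ and a subgroup H₁ with ⟦H₁,G₁⟧ order-isomorphic to L; (4) there exist a finite group G₂ and a subgroup H₂ with ⟦H₂,G₂⟧ order-isomorphic to L_c. Then these hypotheses are contradictory (False follows). -/

import Mathlib

/-- The correspondence theorem for a surjective homomorphism, relative to a subgroup `H` of the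
codomain. -/
def Subgroup.iccOrderIsoIccComap {G K : Type*} [Group G] [Group K] (f : G →* K)
    (hf : Function.Surjective f) (H : Subgroup K) :
    Set.Icc H (⊤ : Subgroup K) ≃o Set.Icc (H.comap f) (⊤ : Subgroup G) where
  toFun A := ⟨A.1.comap f, Subgroup.comap_mono A.2.1, le_top⟩
  invFun B := ⟨B.1.map f, (Subgroup.map_comap_eq_self_of_surjective hf H).ge.trans
    (Subgroup.map_mono B.2.1), le_top⟩
  left_inv A := Subtype.ext (Subgroup.map_comap_eq_self_of_surjective hf A.1)
  right_inv B := Subtype.ext (Subgroup.comap_map_eq_self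
    ((Subgroup.comap_mono (f := f) (bot_le : ⊥ ≤ H)).trans B.2.1))
  map_rel_iff' := Subgroup.comap_le_comap_of_surjective hf

/-- A group property and its negation cannot both be interval
enforceable by group representable lattices. -/
theorem stmt_1
    (P : ∀ (G : Type) [Group G] [Finite G], Prop)
    (L Lc : Type) [Lattice L] [Finite L] [Lattice Lc] [Finite Lc]
    (hIE : ∀ (G : Type) [Group G] [Finite G] (H : Subgroup G),
        Nonempty (L ≃o Set.Icc H (⊤ : Subgroup G)) → P G)
    (hIEc : ∀ (G : Type) [Group G] [Finite G] (H : Subgroup G),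
        Nonempty (Lc ≃o Set.Icc H (⊤ : Subgroup G)) → ¬ P G)
    (G₁ : Type) [Group G₁] [Finite G₁] (H₁ : Subgroup G₁)
    (hrep : Nonempty (L ≃o Set.Icc H₁ (⊤ : Subgroup G₁)))
    (G₂ : Type) [Group G₂] [Finite G₂] (H₂ : Subgroup G₂)
    (hrepc : Nonempty (Lc ≃o Set.Icc H₂ (⊤ : Subgroup G₂))) :
    False := by
  obtain ⟨e⟩ := hrep
  obtain ⟨ec⟩ := hrepc
  exact hIEc (G₁ × G₂) _
    ⟨ec.trans (Subgroup.iccOrderIsoIccComap (MonoidHom.snd G₁ G₂) Prod.snd_surjective H₂)⟩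
    (hIE (G₁ × G₂) _
      ⟨e.trans (Subgroup.iccOrderIsoIccComap (MonoidHom.fst G₁ G₂) Prod.fst_surjective H₁)⟩)
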